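/- Let p ≥ 1 and q ≥ 0 be natural numbers, let Q : ℝ^p × ℝ^q → ℝ be the quadratic form Q(x,y) = ‖x‖² − ‖y‖², and let c > 0. Then the inclusion of the set {v ∈ ℝ^p × ℝ^q : Q(v) ≥ c} into the positive cone K = {v : Q(v) > 0} is a homotopy equivalence; in particular {v : Q(v) ≥ c} is homotopy equivalent to the sphere S^{p−1}. -/

import Mathlib

open scoped unitInterval

section NormCone

variable {E F : Type*} [NormedAddCommGroup E] [NormedAddCommGroup F]

theorem norm_fst_pos_of_norm_sq_sub_norm_sq_pos {v : E × F}
    (hv : 0 < ‖v.1‖ ^ 2 - ‖v.2‖ ^ 2) : 0 < ‖v.1‖ := by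
  by_contra! h
  have h0 : ‖v.1‖ = 0 := le_antisymm h (norm_nonneg _)
  rw [h0] at hv
  nlinarith [sq_nonneg ‖v.2‖]

variable [NormedSpace ℝ E] [NormedSpace ℝ F]

theorem norm_sq_sub_norm_sq_smul (k : ℝ) (v : E × F) :
    ‖(k • v).1‖ ^ 2 - ‖(k • v).2‖ ^ 2 = k ^ 2 * (‖v.1‖ ^ 2 - ‖v.2‖ ^ 2) := by
  simp only [Prod.smul_fst, Prod.smul_snd, norm_smul, mul_pow, Real.norm_eq_abs, sq_abs]
  ring

theorem norm_sq_sub_norm_sq_le_smul {k : ℝ} (hk : 1 ≤ k) {v : E × F}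
    (hv : 0 ≤ ‖v.1‖ ^ 2 - ‖v.2‖ ^ 2) :
    ‖v.1‖ ^ 2 - ‖v.2‖ ^ 2 ≤ ‖(k • v).1‖ ^ 2 - ‖(k • v).2‖ ^ 2 := by
  rw [norm_sq_sub_norm_sq_smul]
  exact le_mul_of_one_le_left hv (one_le_pow₀ hk)

theorem le_norm_sq_sub_norm_sq_one_add_div_smul {c : ℝ} (hc : 0 ≤ c) {v : E × F}
    (hv : 0 < ‖v.1‖ ^ 2 - ‖v.2‖ ^ 2) :
    c ≤ ‖((1 + c / (‖v.1‖ ^ 2 - ‖v.2‖ ^ 2)) • v).1‖ ^ 2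
      - ‖((1 + c / (‖v.1‖ ^ 2 - ‖v.2‖ ^ 2)) • v).2‖ ^ 2 := by
  rw [norm_sq_sub_norm_sq_smul]
  set r := ‖v.1‖ ^ 2 - ‖v.2‖ ^ 2
  have hd : 0 ≤ c / r := by positivity
  have hcr : c / r * r = c := div_mul_cancel₀ c hv.ne'
  calc c ≤ (1 + c / r) * r := by linarith
    _ ≤ (1 + c / r) ^ 2 * r := by gcongr; nlinarith

theorem norm_sq_sub_norm_sq_radial_pos {v : E × F} (hv : 0 < ‖v.1‖ ^ 2 - ‖v.2‖ ^ 2)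
    {t : ℝ} (ht₀ : 0 ≤ t) (ht₁ : t ≤ 1) :
    0 < ‖((1 - t) * ‖v.1‖⁻¹ + t) • v.1‖ ^ 2 - ‖t • v.2‖ ^ 2 := by
  have hx := norm_fst_pos_of_norm_sq_sub_norm_sq_pos hv
  have h : ((1 - t) * ‖v.1‖⁻¹ + t) * ‖v.1‖ = (1 - t) + t * ‖v.1‖ := by
    field_simp
  rw [norm_smul, norm_smul, mul_pow, mul_pow, Real.norm_eq_abs, Real.norm_eq_abs, sq_abs, sq_abs,
    ← mul_pow, h]
  rcases ht₀.eq_or_lt with rfl | ht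
  · norm_num
  · have h₁ := mul_pos (pow_pos ht 2) hv
    have h₂ := mul_nonneg (mul_nonneg (sub_nonneg.2 ht₁) ht₀) hx.le
    nlinarith [sq_nonneg (1 - t)]

/-- The inclusion of `{Q ≥ c}` into `{Q > 0}`, where `Q v = ‖v.1‖ ^ 2 - ‖v.2‖ ^ 2`, as a homotopy
equivalence, with inverse the scaling `v ↦ (1 + c / Q v) • v`. -/
noncomputable def superlevelHomotopyEquivPositiveCone {c : ℝ} (hc : 0 < c) :
    ContinuousMap.HomotopyEquiv {v : E × F // ‖v.1‖ ^ 2 - ‖v.2‖ ^ 2 ≥ c}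
      {v : E × F // ‖v.1‖ ^ 2 - ‖v.2‖ ^ 2 > 0} where
  toFun := ⟨fun v => ⟨v, hc.trans_le v.2⟩, by fun_prop⟩
  invFun := ⟨fun v => ⟨(1 + c / (‖v.1.1‖ ^ 2 - ‖v.1.2‖ ^ 2)) • v.1,
      le_norm_sq_sub_norm_sq_one_add_div_smul hc.le v.2⟩, by
    have h (v : {v : E × F // ‖v.1‖ ^ 2 - ‖v.2‖ ^ 2 > 0}) : ‖v.1.1‖ ^ 2 - ‖v.1.2‖ ^ 2 ≠ 0 :=
      v.2.ne'
    fun_prop (disch := assumption)⟩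
  left_inv := ⟨{
    toFun := fun z => ⟨(1 + (1 - (z.1 : ℝ)) * (c / (‖z.2.1.1‖ ^ 2 - ‖z.2.1.2‖ ^ 2))) • z.2.1, by
      have hQ := hc.trans_le z.2.2
      have ht := sub_nonneg.2 z.1.2.2
      exact z.2.2.trans (norm_sq_sub_norm_sq_le_smul
        (le_add_of_nonneg_right (mul_nonneg ht (div_pos hc hQ).le)) hQ.le)⟩
    continuous_toFun := by
      have h (z : I × {v : E × F // ‖v.1‖ ^ 2 - ‖v.2‖ ^ 2 ≥ c}) :
          ‖z.2.1.1‖ ^ 2 - ‖z.2.1.2‖ ^ 2 ≠ 0 := (hc.trans_le z.2.2).ne'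
      fun_prop (disch := assumption)
    map_zero_left := fun v => by ext1; simp
    map_one_left := fun v => by ext1; simp }⟩
  right_inv := ⟨{
    toFun := fun z => ⟨(1 + (1 - (z.1 : ℝ)) * (c / (‖z.2.1.1‖ ^ 2 - ‖z.2.1.2‖ ^ 2))) • z.2.1, by
      have hQ := gt_iff_lt.1 z.2.2
      have ht := sub_nonneg.2 z.1.2.2
      exact hQ.trans_le (norm_sq_sub_norm_sq_le_smul
        (le_add_of_nonneg_right (mul_nonneg ht (div_pos hc hQ).le)) hQ.le)⟩
    continuous_toFun := by
      have h (z : I × {v : E × F // ‖v.1‖ ^ 2 - ‖v.2‖ ^ 2 > 0}) :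
          ‖z.2.1.1‖ ^ 2 - ‖z.2.1.2‖ ^ 2 ≠ 0 := z.2.2.ne'
      fun_prop (disch := assumption)
    map_zero_left := fun v => by ext1; simp
    map_one_left := fun v => by ext1; simp }⟩

/-- The positive cone `{v | ‖v.1‖ ^ 2 - ‖v.2‖ ^ 2 > 0}` deformation retracts onto the unit sphere
of the first factor. -/
noncomputable def positiveConeHomotopyEquivSphere :
    ContinuousMap.HomotopyEquiv {v : E × F // ‖v.1‖ ^ 2 - ‖v.2‖ ^ 2 > 0}
      (Metric.sphere (0 : E) 1) where
  toFun := ⟨fun v => ⟨‖v.1.1‖⁻¹ • v.1.1, by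
      have hx := norm_fst_pos_of_norm_sq_sub_norm_sq_pos v.2
      rw [mem_sphere_zero_iff_norm, norm_smul, norm_inv, norm_norm, inv_mul_cancel₀ hx.ne']⟩, by
    have h (v : {v : E × F // ‖v.1‖ ^ 2 - ‖v.2‖ ^ 2 > 0}) : ‖v.1.1‖ ≠ 0 :=
      (norm_fst_pos_of_norm_sq_sub_norm_sq_pos v.2).ne'
    fun_prop (disch := assumption)⟩
  invFun := ⟨fun u => ⟨(u, 0), by simp⟩, by fun_prop⟩
  left_inv := ⟨{
    toFun := fun z => ⟨(((1 - (z.1 : ℝ)) * ‖z.2.1.1‖⁻¹ + z.1) • z.2.1.1, (z.1 : ℝ) • z.2.1.2),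
      norm_sq_sub_norm_sq_radial_pos z.2.2 z.1.2.1 z.1.2.2⟩
    continuous_toFun := by
      have h (z : I × {v : E × F // ‖v.1‖ ^ 2 - ‖v.2‖ ^ 2 > 0}) : ‖z.2.1.1‖ ≠ 0 :=
        (norm_fst_pos_of_norm_sq_sub_norm_sq_pos z.2.2).ne'
      fun_prop (disch := assumption)
    map_zero_left := fun v => by ext1; simp
    map_one_left := fun v => by ext1; simp }⟩
  right_inv := by
    convert ContinuousMap.Homotopic.refl _
    ext u
    simp

end NormCone


/-- For the quadratic form `Q(x,y) = ‖x‖² − ‖y‖²` on `ℝ^p × ℝ^q` (p ≥ 1) and `c > 0`,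
the inclusion `{v : Q v ≥ c} ↪ K = {v : Q v > 0}` is a homotopy equivalence;
in particular `{v : Q v ≥ c}` is homotopy equivalent to the sphere `S^{p−1}`. -/
theorem incl_Qge_positiveCone_homotopyEquiv (p q : ℕ) (hp : 1 ≤ p) (c : ℝ) (hc : 0 < c) :
    (∃ h : ContinuousMap.HomotopyEquiv
        {v : EuclideanSpace ℝ (Fin p) × EuclideanSpace ℝ (Fin q) // ‖v.1‖ ^ 2 - ‖v.2‖ ^ 2 ≥ c}
        {v : EuclideanSpace ℝ (Fin p) × EuclideanSpace ℝ (Fin q) // ‖v.1‖ ^ 2 - ‖v.2‖ ^ 2 > 0},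
      ∀ s, (h.toFun s : EuclideanSpace ℝ (Fin p) × EuclideanSpace ℝ (Fin q)) =
        (s : EuclideanSpace ℝ (Fin p) × EuclideanSpace ℝ (Fin q))) ∧
    Nonempty (ContinuousMap.HomotopyEquiv
      {v : EuclideanSpace ℝ (Fin p) × EuclideanSpace ℝ (Fin q) // ‖v.1‖ ^ 2 - ‖v.2‖ ^ 2 ≥ c}
      (Metric.sphere (0 : EuclideanSpace ℝ (Fin p)) 1)) := by
  exact ⟨⟨superlevelHomotopyEquivPositiveCone hc, fun _ => rfl⟩,
    ⟨(superlevelHomotopyEquivPositiveCone hc).trans positiveConeHomotopyEquivSphere⟩⟩
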